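/- Equivalence of the block-sequential restriction and the MAR-type restriction under monotonicity: let X_1, X_2 be full-data variables with missingness indicators R_1, R_2 ∈ {0,1} and proxy L_1 of X_1, and suppose P(X_1 = x_1, X_2 = x_2, R_1 = r_1) > 0 for all x_1, x_2, r_1. Assume monotonicity: P(R_2 = 1, R_1 = 0) = 0. Then the following are equivalent: (a) for all x_1, x_2 and r_1 ∈ {0,1}: P(R_2 = 1 | R_1 = r_1, X_1 = x_1, X_2 = x_2) = P(R_2 = 1 | R_1 = r_1, X_1 = x_1) [the block-sequential restriction, conditioning on the full-data variable X_1]; (b) for all x_2, all l_1 in the state space of L_1 with P(R_1 = r_1, L_1 = l_1) > 0, and r_1 ∈ {0,1}: P(R_2 = 1 | R_1 = r_1, L_1 = l_1, X_2 = x_2) = P(R_2 = 1 | R_1 = r_1, L_1 = l_1) [the restriction conditioning on the proxy L_1]. -/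

import Mathlib

open MeasureTheory

/-- `Pr P A` is the probability of the event `A` under the probability measure `P`. -/
noncomputable def Pr {Ω : Type*} [MeasurableSpace Ω] (P : Measure Ω) (A : Set Ω) : ℝ :=
  (P A).toReal

/-- `cPr P A B` is the conditional probability `P(A | B) = P(A ∩ B) / P(B)`. -/
noncomputable def cPr {Ω : Type*} [MeasurableSpace Ω] (P : Measure Ω) (A B : Set Ω) : ℝ :=
  Pr P (A ∩ B) / Pr P B

/-- Conditional probabilities of an event vanish given any event it meets in a null set. -/
theorem cPr_eq_zero_of_inter_subset {Ω : Type*} [MeasurableSpace Ω] {P : Measure Ω}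
    [IsFiniteMeasure P] {A B N : Set Ω} (hN : Pr P N = 0) (h : A ∩ B ⊆ N) : cPr P A B = 0 := by
  have hAB : P (A ∩ B) = 0 :=
    measure_mono_null h ((ENNReal.toReal_eq_zero_iff _).1 hN |>.resolve_right (measure_ne_top P N))
  simp [cPr, Pr, hAB]

/-- under monotonicity, the block-sequential restriction (conditioning on the
full-data variable `X₁`) is equivalent to the MAR-type restriction (conditioning on the
proxy `L₁`). -/
theorem block_sequential_iff_mar_under_monotonicity
    {Ω : Type*} [MeasurableSpace Ω] (P : Measure Ω) [IsProbabilityMeasure P]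
    {α₁ α₂ : Type*} [Fintype α₁] [Nonempty α₁] [Fintype α₂] [Nonempty α₂]
    (X₁ : Ω → α₁) (X₂ : Ω → α₂) (R₁ R₂ : Ω → Bool) (L₁ : Ω → Option α₁)
    -- consistency: L₁ is the proxy of X₁
    (hL₁ : ∀ ω, L₁ ω = if R₁ ω then some (X₁ ω) else none)
    -- positivity of the joint law of (X₁, X₂, R₁)
    (hpos : ∀ (x₁ : α₁) (x₂ : α₂) (r₁ : Bool),
      0 < Pr P {ω | X₁ ω = x₁ ∧ X₂ ω = x₂ ∧ R₁ ω = r₁})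
    -- monotonicity: P(R₂ = 1, R₁ = 0) = 0
    (hmono : Pr P {ω | R₂ ω = true ∧ R₁ ω = false} = 0) :
    -- (a) the block-sequential restriction
    ((∀ (x₁ : α₁) (x₂ : α₂) (r₁ : Bool),
      cPr P {ω | R₂ ω = true} {ω | R₁ ω = r₁ ∧ X₁ ω = x₁ ∧ X₂ ω = x₂}
        = cPr P {ω | R₂ ω = true} {ω | R₁ ω = r₁ ∧ X₁ ω = x₁})
    ↔
    -- (b) the restriction conditioning on the proxy L₁
    (∀ (x₂ : α₂) (l₁ : Option α₁) (r₁ : Bool),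
      0 < Pr P {ω | R₁ ω = r₁ ∧ L₁ ω = l₁} →
      cPr P {ω | R₂ ω = true} {ω | R₁ ω = r₁ ∧ L₁ ω = l₁ ∧ X₂ ω = x₂}
        = cPr P {ω | R₂ ω = true} {ω | R₁ ω = r₁ ∧ L₁ ω = l₁})) := by
  have cPr_of_unobserved (p : Ω → Prop) :
      cPr P {ω | R₂ ω = true} {ω | R₁ ω = false ∧ p ω} = 0 :=
    cPr_eq_zero_of_inter_subset hmono fun ω h => ⟨h.1, h.2.1⟩
  have proxy_iff (x₁ : α₁) (ω : Ω) :
      (R₁ ω = true ∧ L₁ ω = some x₁) ↔ (R₁ ω = true ∧ X₁ ω = x₁) := by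
    rw [hL₁]
    cases R₁ ω <;> simp
  have proxy_iff_and (x₁ : α₁) (x₂ : α₂) (ω : Ω) :
      (R₁ ω = true ∧ L₁ ω = some x₁ ∧ X₂ ω = x₂) ↔
        (R₁ ω = true ∧ X₁ ω = x₁ ∧ X₂ ω = x₂) := by
    rw [← and_assoc, proxy_iff, and_assoc]
  constructor
  · rintro h x₂ l₁ (_ | _) hl
    · rw [cPr_of_unobserved, cPr_of_unobserved]
    · cases l₁ with
      | none =>
        have hempty : {ω | R₁ ω = true ∧ L₁ ω = none} = ∅ := by
          ext ω
          simp +contextual [hL₁]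
        simp [hempty, Pr] at hl
      | some x₁ =>
        simp only [proxy_iff, proxy_iff_and]
        exact h x₁ x₂ true
  · rintro h x₁ x₂ (_ | _)
    · rw [cPr_of_unobserved, cPr_of_unobserved]
    · have hobs : 0 < Pr P {ω | R₁ ω = true ∧ L₁ ω = some x₁} := by
        simp only [proxy_iff]
        exact (hpos x₁ x₂ true).trans_le <| ENNReal.toReal_mono (measure_ne_top P _) <|
          measure_mono fun ω hω => ⟨hω.2.2, hω.1⟩
      simpa only [proxy_iff, proxy_iff_and] using h x₂ (some x₁) true hobs
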